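/- Let A, B, C, D be complex matrices of compatible sizes with A, D square. Set S = A − C D^d B, H = B A^d, K = A^d C, Γ = H K, Z = D − B A^d C, and k = ind(A). If A^π C D^d B = 0, C Γ^d Z D^d B = 0, C Γ^d D^π B = 0, and C Γ^π D^d B = 0, then S^d = (I − K Γ^d H) A^d (I − K Γ^d H) + ∑_{i=0}^{k-1} ((I − K Γ^d H) A^d)^{i+2} K Γ^d B A^i A^π. -/

import Mathlib

open Matrix Finset

attribute [local instance] Classical.propDecidable

noncomputable def drazin {n : Type*} [Fintype n] [DecidableEq n]
    (A : Matrix n n ℂ) : Matrix n n ℂ :=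
  if h : ∃ X : Matrix n n ℂ,
      A * X = X * A ∧ X * A * X = X ∧ ∃ k : ℕ, A ^ (k + 1) * X = A ^ k
  then h.choose else 0

noncomputable def ind {n : Type*} [Fintype n] [DecidableEq n]
    (A : Matrix n n ℂ) : ℕ :=
  sInf {k : ℕ | (A ^ k).rank = (A ^ (k + 1)).rank}

noncomputable def spi {n : Type*} [Fintype n] [DecidableEq n]
    (A : Matrix n n ℂ) : Matrix n n ℂ :=
  1 - A * drazin A

set_option linter.unusedSimpArgs false

/-- Factorization from equality of ranks. -/
theorem factor_right {n : ℕ} (P Q M : Matrix (Fin n) (Fin n) ℂ) (h : P = Q * M)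
    (hr : Q.rank ≤ P.rank) : ∃ Y, Q = P * Y := by
  have hle : LinearMap.range P.mulVecLin ≤ LinearMap.range Q.mulVecLin := by
    rw [h, Matrix.mulVecLin_mul]
    exact LinearMap.range_comp_le_range _ _
  have heq : LinearMap.range P.mulVecLin = LinearMap.range Q.mulVecLin :=
    Submodule.eq_of_le_of_finrank_le hle hr
  have hx : ∀ j : Fin n, ∃ y, P *ᵥ y = Q *ᵥ (Pi.single j 1) := by
    intro j
    have : Q.mulVecLin (Pi.single j 1) ∈ LinearMap.range P.mulVecLin := by
      rw [heq]; exact LinearMap.mem_range_self _ _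
    obtain ⟨y, hy⟩ := this
    exact ⟨y, by simpa using hy⟩
  choose y hy using hx
  refine ⟨Matrix.of fun i j => y j i, ?_⟩
  ext i j
  have := congrFun (hy j) i
  simp only [Matrix.mulVec_single_one, Matrix.col_apply] at this
  rw [← this]
  simp [Matrix.mul_apply, Matrix.mulVec, dotProduct]

theorem factor_left {n : ℕ} (P Q M : Matrix (Fin n) (Fin n) ℂ) (h : P = M * Q)
    (hr : Q.rank ≤ P.rank) : ∃ Y, Q = Y * P := by
  obtain ⟨Y, hY⟩ := factor_right Pᵀ Qᵀ Mᵀ (by rw [h, Matrix.transpose_mul])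
    (by rwa [Matrix.rank_transpose, Matrix.rank_transpose])
  refine ⟨Yᵀ, ?_⟩
  rw [← Matrix.transpose_transpose Q, hY, Matrix.transpose_mul, Matrix.transpose_transpose]

theorem drazin_exists {n : ℕ} (A : Matrix (Fin n) (Fin n) ℂ) :
    ∃ X : Matrix (Fin n) (Fin n) ℂ,
      A * X = X * A ∧ X * A * X = X ∧ ∃ k : ℕ, A ^ (k + 1) * X = A ^ k := by
  have hU : ∃ (k : ℕ) (U : Matrix (Fin n) (Fin n) ℂ), Commute A U ∧ A ^ (k + 1) * U = A ^ k := by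
    let R := Algebra.adjoin ℂ {A}
    let _ : CommRing R := Algebra.adjoinCommRingOfComm ℂ (by
      intro a ha b hb
      rw [Set.mem_singleton_iff] at ha hb
      rw [ha, hb])
    have : IsArtinianRing R := IsArtinianRing.of_finite ℂ R
    let r : R := ⟨A, Algebra.self_mem_adjoin_singleton ℂ A⟩
    obtain ⟨k, y, hy⟩ := IsArtinian.exists_pow_succ_smul_dvd (M := R) r 1
    refine ⟨k, y.1, ?_, ?_⟩
    · exact congrArg Subtype.val (mul_comm r y)
    · have := congrArg Subtype.val hy
      simpa [r] using this
  obtain ⟨k, U, hc, hk⟩ := hU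
  have hj : ∀ j, A ^ (k + j) * U ^ j = A ^ k := by
    intro j
    induction j with
    | zero => simp
    | succ j ih =>
      calc A ^ (k + (j + 1)) * U ^ (j + 1) = A ^ j * (A ^ (k + 1) * U) * U ^ j := by
            rw [← mul_assoc, ← pow_add, mul_assoc, ← pow_succ']; congr 2; omega
        _ = A ^ k := by rw [hk, ← pow_add, add_comm j k, ih]
  have hcj : ∀ i j, Commute (A ^ i) (U ^ j) := fun i j => hc.pow_pow i j
  refine ⟨A ^ k * U ^ (k + 1), ?_, ?_, k, ?_⟩
  · rw [mul_assoc, ← (hc.pow_right (k+1)).eq, ← mul_assoc, ← mul_assoc, ← pow_succ, ← pow_succ']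
  · calc A ^ k * U ^ (k + 1) * A * (A ^ k * U ^ (k + 1))
        = A ^ k * (U ^ (k + 1) * A ^ (k + 1)) * U ^ (k + 1) := by
          rw [pow_succ' A k]; simp only [mul_assoc]
      _ = A ^ (k + (k + 1)) * U ^ (k + 1) * U ^ (k + 1) := by
          rw [← (hcj (k+1) (k+1)).eq, ← mul_assoc, ← pow_add]
      _ = _ := by rw [hj]
  · rw [← mul_assoc, ← pow_add, add_comm (k + 1) k, hj]

theorem drazin_spec {n : ℕ} (A : Matrix (Fin n) (Fin n) ℂ) :
    A * drazin A = drazin A * A ∧ drazin A * A * drazin A = drazin A ∧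
      ∃ k : ℕ, A ^ (k + 1) * drazin A = A ^ k := by
  have h := drazin_exists A
  unfold drazin
  rw [dif_pos h]
  exact h.choose_spec

theorem pow_proj {R : Type*} [Ring R] (A X : R) (h1 : A * X = X * A) (h2 : X * A * X = X) (k : ℕ) :
    A ^ (k + 1) * X ^ (k + 1) = A * X := by
  induction k with
  | zero => simp
  | succ k ih =>
    rw [pow_succ' A, pow_succ X, mul_assoc, ← mul_assoc (A ^ (k+1)), ih]
    have e : A * X * X = X := by rw [h1, h2]
    rw [e]

theorem pow_projection {R : Type*} [Ring R] (A X Y : R) (hA : A * X = X * A)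
    (k : ℕ) (hk : A ^ (k + 1) * X = A ^ k) (h1 : A * Y = Y * A) (h2 : Y * A * Y = Y) :
    A * X * (A * Y) = A * Y := by
  have e := pow_proj A Y h1 h2 k
  rw [← e, ← mul_assoc, pow_succ, ← mul_assoc (A * X)]
  have c : A * X * A ^ k = A ^ k := by
    have : Commute X (A ^ k) := Commute.pow_right hA.symm k
    rw [mul_assoc, this.eq, ← mul_assoc, ← pow_succ', hk]
  rw [c]

theorem drazin_unique {n : ℕ} (A X : Matrix (Fin n) (Fin n) ℂ) (h1 : A * X = X * A)
    (h2 : X * A * X = X) (h3 : ∃ k : ℕ, A ^ (k + 1) * X = A ^ k) : drazin A = X := by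
  obtain ⟨e1, e2, k, e3⟩ := drazin_spec A
  obtain ⟨l, h3⟩ := h3
  set Y := drazin A
  have p1 := pow_projection A X Y h1 l h3 e1 e2
  have p2 := pow_projection A Y X e1 k e3 h1 h2
  have cc : A * X * (A * Y) = A * Y * (A * X) := by
    have a1 : Commute A X := h1
    have hX : X = A ^ 0 * X := by simp
    -- both are projections with the same range; use Y (A X) and commutation with A
    have q1 : A ^ (k + 1) * Y ^ (k + 1) = Y ^ (k + 1) * A ^ (k + 1) :=
      (Commute.pow_pow (show Commute A Y from e1) _ _).eq
    have cX : A ^ (l + 1) * (A * X) = A ^ (l + 1) := by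
      rw [← mul_assoc, ← pow_succ, pow_succ' A (l+1), mul_assoc, h3, ← pow_succ']
    have q2 : A * Y * (A * X) = A * Y := by
      have e := pow_proj A Y e1 e2 l
      have q : A ^ (l + 1) * Y ^ (l + 1) = Y ^ (l + 1) * A ^ (l + 1) :=
        (Commute.pow_pow (show Commute A Y from e1) _ _).eq
      rw [← e, q, mul_assoc, cX]
    rw [p1, q2]
  have pe : A * X = A * Y := by rw [← p2, ← cc, p1]
  calc Y = Y * (A * Y) := by rw [← mul_assoc, e2]
    _ = (A * Y) * X := by rw [← pe, ← mul_assoc, ← e1, pe]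
    _ = X := by rw [← pe, h1, h2]

theorem spi_pow {n : ℕ} (A : Matrix (Fin n) (Fin n) ℂ) : A ^ (ind A) * spi A = 0 := by
  obtain ⟨e1, e2, j, e3⟩ := drazin_spec A
  have hc : Commute A (spi A) := by
    unfold spi
    exact (Commute.one_right A).sub_right ((Commute.refl A).mul_right e1)
  have hj : A ^ j * spi A = 0 := by
    unfold spi; rw [mul_sub, mul_one, ← mul_assoc, ← pow_succ, e3, sub_self]
  have hmem : ind A ∈ {k : ℕ | (A ^ k).rank = (A ^ (k + 1)).rank} := by
    apply Nat.sInf_mem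
    refine ⟨j, ?_⟩
    apply le_antisymm
    · conv_lhs => rw [← e3]
      exact Matrix.rank_mul_le_left _ _
    · rw [pow_succ]; exact Matrix.rank_mul_le_left _ _
  obtain ⟨Y, hY⟩ := factor_right (A ^ (ind A + 1)) (A ^ ind A) A (pow_succ _ _) (le_of_eq hmem)
  set k := ind A
  have hl : ∀ l, spi A * A ^ k = A ^ l * (spi A * A ^ k) * Y ^ l := by
    intro l
    induction l with
    | zero => simp
    | succ l ih =>
      have hs : spi A * A ^ k = A * (spi A * A ^ k) * Y := by
        conv_lhs => rw [hY]
        rw [pow_succ' A k, ← mul_assoc, ← mul_assoc, ← hc.eq]; simp only [mul_assoc]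
      conv_lhs => rw [ih, hs]
      rw [pow_succ A l, pow_succ' Y l]; simp only [mul_assoc]
  rw [(hc.pow_left k).eq, hl j, ← mul_assoc, hj]; simp

/-- The ring-theoretic core. -/
theorem core {R : Type*} [Ring R] (A a P Q W : R) (k : ℕ)
    (ca : A * a = a * A) (aAa : a * A * a = a) (hk : A ^ k * (1 - A * a) = 0)
    (AaP : A * a * P = P) (AaQ : A * a * Q = Q) (PaQ : P * a * Q = Q)
    (QaaP : Q * a * a * P = P) (QaP : Q * a * P = Q) (PaaQ : P * a * a * Q = P)
    (QaaQ : Q * a * a * Q = Q)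
    (hW : W = (1 - a * Q * a) * a * (a * Q) * (1 - A * a) + (1 - a * Q * a) * a * W * A)
    (hWpi : W * (A * a) = 0) :
    let S := A - P
    let X := (1 - a * Q * a) * a * (1 - a * Q * a) + (1 - a * Q * a) * a * W
    S * X = X * S ∧ X * S * X = X ∧ S ^ (k + 2) * X = S ^ (k + 1) := by
  intro S X
  have x1 : ∀ Y, A * (a * Y) = a * (A * Y) := fun Y => by rw [← mul_assoc, ca, mul_assoc]
  have aaA : a * (a * A) = a := by rw [← ca, ← mul_assoc, aAa]
  have aaA' : ∀ Y, a * (a * (A * Y)) = a * Y := fun Y => by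
    rw [← mul_assoc a A, ← mul_assoc, aaA]
  simp only [mul_assoc, x1] at AaP AaQ PaQ QaaP QaP PaaQ QaaQ
  have y1 : ∀ Y, a * (A * (P * Y)) = P * Y := fun Y => by
    rw [← mul_assoc A, ← mul_assoc, AaP]
  have y2 : ∀ Y, a * (A * (Q * Y)) = Q * Y := fun Y => by
    rw [← mul_assoc A, ← mul_assoc, AaQ]
  have y3 : ∀ Y, P * (a * (Q * Y)) = Q * Y := fun Y => by
    rw [← mul_assoc a, ← mul_assoc, PaQ]
  have y4 : ∀ Y, Q * (a * (P * Y)) = Q * Y := fun Y => by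
    rw [← mul_assoc a, ← mul_assoc, QaP]
  have y5 : ∀ Y, Q * (a * (a * (P * Y))) = P * Y := fun Y => by
    rw [← mul_assoc a P, ← mul_assoc a, ← mul_assoc, QaaP]
  have y6 : ∀ Y, P * (a * (a * (Q * Y))) = P * Y := fun Y => by
    rw [← mul_assoc a Q, ← mul_assoc a, ← mul_assoc, PaaQ]
  have y7 : ∀ Y, Q * (a * (a * (Q * Y))) = Q * Y := fun Y => by
    rw [← mul_assoc a Q, ← mul_assoc a, ← mul_assoc, QaaQ]
  -- M = F a
  obtain ⟨M, hM⟩ : ∃ M, M = (1 - a * Q * a) * a := ⟨_, rfl⟩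
  have hX : X = M * (1 - a * Q * a) + M * W := by rw [hM]
  rw [← hM] at hW
  have SM : S * M = A * a - P * a := by
    simp only [S, hM, mul_sub, sub_mul, mul_one, one_mul, mul_assoc, ca, x1, y2, y3]
    abel
  have LM : (A * a - P * a) * M = M := by
    simp only [hM, mul_sub, sub_mul, mul_one, one_mul, mul_assoc, ca, x1, y1, y2, y3, y6, aaA, aaA']
    abel
  have SMM : S * M * M = M := by rw [SM, LM]
  have WP : W * P = 0 := by
    have : W * (A * a) * P = W * P := by simp only [mul_assoc, x1, AaP]
    rw [← this, hWpi, zero_mul]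
  have Wf : W = M * ((a * Q) * (1 - A * a) + W * A) := by
    conv_lhs => rw [hW]
    simp only [mul_add, mul_assoc]
  have SMW : S * M * W = W := by
    conv_lhs => rw [Wf]
    rw [← mul_assoc, SMM, ← Wf]
  have MWA : M * W * A = W - M * (a * Q) * (1 - A * a) := by
    conv_rhs => rw [hW]
    abel
  set p := 1 - A * a with hp
  have SX : S * X = A * a - a * Q * a + W := by
    have : S * X = S * M * (1 - a * Q * a) + S * M * W := by
      simp only [hX, mul_add, mul_assoc]
    rw [this, SMW, SM]
    simp only [mul_sub, sub_mul, mul_one, mul_assoc, ca, x1, y2, y6]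
    abel
  have XS : X * S = A * a - a * Q * a + W := by
    have h1 : X * S = M * (1 - a * Q * a) * S + (M * W * A - M * (W * P)) := by
      rw [hX, add_mul, mul_assoc M W S]; simp only [S, mul_sub, mul_assoc]
    rw [h1, WP, MWA, mul_zero, sub_zero]
    have h2 : M * (1 - a * Q * a) * S = A * a - a * Q * a + M * (a * Q) * p := by
      simp only [S, hM, hp, mul_sub, sub_mul, mul_one, one_mul, mul_assoc, ca, x1, aaA, aaA',
        y1, y2, y3, y4, y5, y6, y7, AaP, AaQ, PaQ, QaaP, QaP, PaaQ, QaaQ]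
      abel
    rw [h2]; abel
  refine ⟨by rw [SX, XS], ?_, ?_⟩
  · have aM : a * (A * M) = M := by
      simp only [hM, mul_sub, sub_mul, mul_one, one_mul, mul_assoc, ca, x1, aaA, y2]
    have EM : a * Q * a * M = 0 := by
      simp only [hM, mul_sub, sub_mul, mul_one, one_mul, mul_assoc, y7, sub_self]
    have WM : W * M = 0 := by
      rw [← aM, ← mul_assoc a, ← mul_assoc, ← ca, hWpi, zero_mul]
    have key : (A * a - a * Q * a + W) * M = M := by
      rw [add_mul, sub_mul, EM, WM, ca, mul_assoc, aM]; abel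
    rw [XS]
    have : X = M * ((1 - a * Q * a) + W) := by rw [hX, mul_add]
    rw [this, ← mul_assoc, key]
  · have SN : S * (a * Q) = 0 := by
      simp only [S, sub_mul, x1, AaQ, PaQ, sub_self]
    have cp : p * A = A * p := by
      simp only [hp, mul_sub, sub_mul, mul_one, one_mul, mul_assoc, ca, x1]
    have SW : S * W = (a * Q - P) * p + W * A := by
      conv_lhs => rw [Wf]
      rw [← mul_assoc, mul_add, ← mul_assoc, ← mul_assoc (S * M) W, SMW, SM]
      congr 2
      simp only [sub_mul, mul_assoc, x1, AaQ, PaaQ]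
    have SY : S * (p - W) = (p - W) * A - a * Q * p := by
      rw [mul_sub, SW]
      simp only [S, sub_mul, cp]
      abel
    have hpow : ∀ j, S ^ (j + 1) * (p - W) = (p - W) * A ^ (j + 1) - a * Q * p * A ^ j := by
      intro j
      induction j with
      | zero => simpa using SY
      | succ j ih =>
        rw [pow_succ' S, mul_assoc, ih, mul_sub, ← mul_assoc, SY]
        have : S * (a * Q * p * A ^ (j)) = 0 := by
          rw [mul_assoc (a * Q), ← mul_assoc S, SN, zero_mul]
        rw [this, sub_mul, mul_assoc, ← pow_succ' A, sub_zero]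
    have hkp : ∀ j, k ≤ j → p * A ^ j = 0 := by
      intro j hj
      obtain ⟨i, rfl⟩ := Nat.exists_eq_add_of_le hj
      have : Commute p A := cp
      rw [(this.pow_right _).eq, add_comm, pow_add, mul_assoc, hk, mul_zero]
    have Wp : W * p = W := by rw [hp, mul_sub, hWpi, mul_one, sub_zero]
    have z1 : S ^ (k + 1) * (p - W) = 0 := by
      have w0 : W * A ^ (k + 1) = 0 := by
        rw [← Wp, mul_assoc, hkp _ (by omega), mul_zero]
      rw [hpow, sub_mul, w0, hkp _ (by omega), mul_assoc (a * Q), hkp _ le_rfl]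
      simp
    have z2 : S ^ (k + 1) * (a * Q * a) = 0 := by
      rw [pow_succ, mul_assoc, ← mul_assoc S, SN]; simp
    have : S * X = 1 - (p - W) - a * Q * a := by
      rw [SX, hp]; abel
    rw [pow_succ S (k + 1), mul_assoc, this, mul_sub, mul_sub, z1, z2]
    simp

theorem stmt13 {n m : ℕ} (A : Matrix (Fin n) (Fin n) ℂ) (D : Matrix (Fin m) (Fin m) ℂ)
    (C : Matrix (Fin n) (Fin m) ℂ) (B : Matrix (Fin m) (Fin n) ℂ)
    (H : Matrix (Fin m) (Fin n) ℂ) (hH : H = B * drazin A)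
    (K : Matrix (Fin n) (Fin m) ℂ) (hK : K = drazin A * C)
    (G : Matrix (Fin m) (Fin m) ℂ) (hG : G = H * K)
    (Z : Matrix (Fin m) (Fin m) ℂ) (hZ : Z = D - B * drazin A * C)
    (S : Matrix (Fin n) (Fin n) ℂ) (hS : S = A - C * drazin D * B)
    (h1 : spi A * (C * drazin D * B) = 0)
    (h2 : C * drazin G * Z * drazin D * B = 0)
    (h3 : C * drazin G * spi D * B = 0)
    (h4 : C * spi G * drazin D * B = 0) :
    drazin S = (1 - K * drazin G * H) * drazin A * (1 - K * drazin G * H) +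
      ∑ i ∈ range (ind A),
        ((1 - K * drazin G * H) * drazin A) ^ (i + 2) * (K * drazin G * B) * A ^ i * spi A := by
  obtain ⟨ca, aAa, -⟩ := drazin_spec A
  obtain ⟨cg, gGg, -⟩ := drazin_spec G
  have hkA := spi_pow A
  have hpi : spi A = 1 - A * drazin A := rfl
  have hpiD : spi D = 1 - D * drazin D := rfl
  have hpiG : spi G = 1 - G * drazin G := rfl
  rw [hpi] at h1 hkA ⊢
  rw [hpiD] at h3
  rw [hpiG] at h4
  set k := ind A
  set a := drazin A
  set d := drazin D
  set g := drazin G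
  have hG' : G = B * a * a * C := by rw [hG, hH, hK]; simp only [Matrix.mul_assoc]
  obtain ⟨P, hP⟩ : ∃ P, P = C * d * B := ⟨_, rfl⟩
  obtain ⟨Q, hQ⟩ : ∃ Q, Q = C * g * B := ⟨_, rfl⟩
  have AaP : A * a * P = P := by
    rw [← hP, sub_mul, one_mul, sub_eq_zero] at h1
    exact h1.symm
  have QaP : Q * a * P = Q := by
    have e3 : C * g * B = C * g * (D * d) * B := by
      rw [Matrix.mul_sub, Matrix.sub_mul, Matrix.mul_one, sub_eq_zero] at h3
      exact h3
    rw [hZ, Matrix.mul_sub, Matrix.sub_mul, Matrix.sub_mul, sub_eq_zero] at h2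
    rw [hQ, hP]
    conv_rhs => rw [e3]
    simp only [Matrix.mul_assoc] at h2 ⊢
    exact h2.symm
  have QaaP : Q * a * a * P = P := by
    rw [Matrix.mul_sub, Matrix.sub_mul, Matrix.sub_mul, Matrix.mul_one, sub_eq_zero, cg] at h4
    rw [hP]
    conv_rhs => rw [h4]
    rw [hQ, hG']
    simp only [Matrix.mul_assoc]
  have QaaQ : Q * a * a * Q = Q := by
    rw [hQ]
    conv_rhs => rw [← gGg]
    rw [hG']
    simp only [Matrix.mul_assoc]
  have rk1 : Q.rank ≤ P.rank := by
    conv_lhs => rw [← QaP]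
    exact Matrix.rank_mul_le_right _ _
  have rk2 : P.rank ≤ Q.rank := by
    conv_lhs => rw [← QaaP, mul_assoc, mul_assoc]
    exact Matrix.rank_mul_le_left _ _
  obtain ⟨Y, hY⟩ := factor_right P Q (a * (a * P)) (by
    rw [← mul_assoc, ← mul_assoc, QaaP]) rk1
  have AaQ : A * a * Q = Q := by
    conv_lhs => rw [hY, ← mul_assoc, AaP]
    exact hY.symm
  obtain ⟨Y2, hY2⟩ := factor_left (Q * a * Q) Q (Q * a) rfl (by
    have : Q = Q * a * Q * (a * a * P) := by
      have : Q * a * Q * (a * a * P) = Q * a * (Q * a * a * P) := by simp only [mul_assoc]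
      rw [this, QaaP, QaP]
    conv_lhs => rw [this]
    exact Matrix.rank_mul_le_left _ _)
  have hPY : P = Y2 * Q := by
    calc P = Q * a * a * P := QaaP.symm
      _ = Y2 * (Q * a * Q) * a * a * P := by rw [← hY2]
      _ = Y2 * (Q * a * (Q * a * a * P)) := by simp only [mul_assoc]
      _ = Y2 * Q := by rw [QaaP, QaP]
  have PaQ : P * a * Q = Q := by
    rw [hPY, mul_assoc, mul_assoc, ← mul_assoc Q, ← hY2]
  have PaaQ : P * a * a * Q = P := by
    have : Y2 * Q * a * a * Q = Y2 * (Q * a * a * Q) := by simp only [mul_assoc]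
    conv_lhs => rw [hPY]
    rw [this, QaaQ, hPY]
  have hE : K * g * H = a * Q * a := by
    rw [hK, hH, hQ]; simp only [Matrix.mul_assoc]
  have hN : K * g * B = a * Q := by
    rw [hK, hQ]; simp only [Matrix.mul_assoc]
  rw [hE, hN]
  have hS' : S = A - P := by rw [hS, hP]
  obtain ⟨M, hM⟩ : ∃ M, M = (1 - a * Q * a) * a := ⟨_, rfl⟩
  obtain ⟨W, hW⟩ : ∃ W, W = ∑ i ∈ range k, M ^ (i + 1) * (a * Q) * A ^ i * (1 - A * a) :=
    ⟨_, rfl⟩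
  have cp : (1 - A * a) * A = A * (1 - A * a) := by
    rw [sub_mul, mul_sub, one_mul, mul_one, mul_assoc, ca]
  have pz : (1 - A * a) * (A * a) = 0 := by
    rw [sub_mul, one_mul, mul_assoc, ← mul_assoc a, aAa, sub_self]
  have Wpi : W * (A * a) = 0 := by
    rw [hW, Finset.sum_mul]
    refine Finset.sum_eq_zero fun i _ => ?_
    rw [mul_assoc, pz, mul_zero]
  have hWf : W = M * (a * Q) * (1 - A * a) + M * W * A := by
    have e : M * W * A =
        ∑ i ∈ range k, M ^ (i + 1 + 1) * (a * Q) * A ^ (i + 1) * (1 - A * a) := by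
      rw [hW, Finset.mul_sum, Finset.sum_mul]
      refine Finset.sum_congr rfl fun i _ => ?_
      rw [pow_succ' M (i + 1), pow_succ A i]
      simp only [mul_assoc, cp]
    have t := Finset.sum_range_succ' (fun i => M ^ (i + 1) * (a * Q) * A ^ i * (1 - A * a)) k
    rw [Finset.sum_range_succ, ← hW, ← e, mul_assoc _ (A ^ k), hkA, mul_zero, add_zero] at t
    simp only [zero_add, pow_one, pow_zero, mul_one] at t
    rw [add_comm]; exact t
  have hT : ∑ i ∈ range k, ((1 - a * Q * a) * a) ^ (i + 2) * (a * Q) * A ^ i * (1 - A * a)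
      = (1 - a * Q * a) * a * W := by
    rw [← hM, hW, Finset.mul_sum]
    refine Finset.sum_congr rfl fun i _ => ?_
    rw [pow_succ' M (i + 1)]
    simp only [mul_assoc]
  rw [hT, hS']
  rw [hM] at hWf
  obtain ⟨r1, r2, r3⟩ := core A a P Q W k ca aAa hkA AaP AaQ PaQ QaaP QaP PaaQ QaaQ hWf Wpi
  exact drazin_unique _ _ r1 r2 ⟨k + 1, r3⟩
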